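/- Let F be an arbitrary field and W an n-dimensional vector space over F. Let U_1, ..., U_m and V_1, ..., V_m be subspaces of W. Assume that for some integer t with 0 ≤ t ≤ n, dim(U_i ∩ V_i) ≤ t for each 1 ≤ i ≤ m, and dim(U_i ∩ V_j) > t whenever i < j (1 ≤ i, j ≤ m). Then m ≤ 2^(n - t). -/

import Mathlib

open Module

theorem ExteriorAlgebra.finrank_eq {K E : Type*} [Field K] [AddCommGroup E] [Module K E]
    [FiniteDimensional K E] : finrank K (ExteriorAlgebra K E) = 2 ^ finrank K E := by
  rw [finrank_eq_card_basis (finBasis K E).ExteriorAlgebra, Fintype.card_finset, Fintype.card_fin]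

instance ExteriorAlgebra.instFiniteDimensional {K E : Type*} [Field K] [AddCommGroup E]
    [Module K E] [FiniteDimensional K E] : FiniteDimensional K (ExteriorAlgebra K E) :=
  (finBasis K E).ExteriorAlgebra.finiteDimensional_of_finite

theorem ExteriorAlgebra.ιMulti_ne_zero_iff {K E : Type*} [Field K] [AddCommGroup E] [Module K E]
    {k : ℕ} {v : Fin k → E} : ιMulti K k v ≠ 0 ↔ LinearIndependent K v := by
  refine ⟨not_imp_comm.1 ((ιMulti K k).map_linearDependent v), fun hv => ?_⟩
  let s : Set.powersetCard (Fin k) k :=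
    Set.powersetCard.ofFinEmbEquiv (RelEmbedding.refl (· ≤ ·))
  have h := (exteriorPower.ιMulti_family_linearIndependent_field (n := k) hv).ne_zero s
  rw [Ne, ← Submodule.coe_eq_zero, exteriorPower.ιMulti_family_apply_coe,
    ιMulti_family, Equiv.symm_apply_apply] at h
  exact h

theorem linearIndependent_finAppend_iff {K E : Type*} [Field K] [AddCommGroup E] [Module K E]
    {k l : ℕ} {v : Fin k → E} {w : Fin l → E} :
    LinearIndependent K (Fin.append v w) ↔ LinearIndependent K v ∧ LinearIndependent K w ∧
      Disjoint (Submodule.span K (Set.range v)) (Submodule.span K (Set.range w)) := by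
  have h : Fin.append v w ∘ finSumFinEquiv = Sum.elim v w := by
    ext (i | i) <;> simp
  rw [← linearIndependent_equiv finSumFinEquiv, h, linearIndependent_sum, Sum.elim_comp_inl,
    Sum.elim_comp_inr]

/-- The exterior product of a basis of `U`. -/
noncomputable def Submodule.blade {K E : Type*} [Field K] [AddCommGroup E] [Module K E]
    [FiniteDimensional K E] (U : Submodule K E) : ExteriorAlgebra K E :=
  ExteriorAlgebra.ιMulti K (finrank K U) fun i => (finBasis K U i : E)

theorem Submodule.blade_mul_blade_ne_zero_iff {K E : Type*} [Field K] [AddCommGroup E]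
    [Module K E] [FiniteDimensional K E] {U V : Submodule K E} :
    U.blade * V.blade ≠ 0 ↔ Disjoint U V := by
  have hli (S : Submodule K E) : LinearIndependent K fun i => (finBasis K S i : E) :=
    (finBasis K S).linearIndependent.map' S.subtype S.ker_subtype
  have hspan (S : Submodule K E) : span K (Set.range fun i => (finBasis K S i : E)) = S := by
    have h := congrArg (map S.subtype) (finBasis K S).span_eq
    rwa [map_span, ← Set.range_comp, map_subtype_top] at h
  rw [blade, blade, ExteriorAlgebra.ιMulti_mul_ιMulti, ExteriorAlgebra.ιMulti_ne_zero_iff,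
    linearIndependent_finAppend_iff, hspan, hspan]
  exact ⟨fun h => h.2.2, fun h => ⟨hli U, hli V, h⟩⟩

theorem linearIndependent_of_mul_triangular {K A ι : Type*} [Field K] [Ring A] [Algebra K A]
    [LinearOrder ι] [Fintype ι] {x y : ι → A} (hdiag : ∀ i, x i * y i ≠ 0)
    (hzero : ∀ i j, i < j → x i * y j = 0) : LinearIndependent K x := by
  rw [Fintype.linearIndependent_iff]
  intro c hc j
  induction j using WellFoundedGT.induction with
  | ind j ih =>
    have h : ∑ i, c i • (x i * y j) = 0 := by
      simpa [Finset.sum_mul] using congrArg (· * y j) hc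
    rw [Fintype.sum_eq_single j] at h
    · exact (smul_eq_zero.1 h).resolve_right (hdiag j)
    · intro i hij
      rcases hij.lt_or_gt with h | h
      · rw [hzero i j h, smul_zero]
      · rw [ih i h, zero_smul]

theorem skew_bollobas_subspaces {K E : Type*} [Field K] [AddCommGroup E] [Module K E]
    [FiniteDimensional K E] {m : ℕ} {U V : Fin m → Submodule K E}
    (hdiag : ∀ i, Disjoint (U i) (V i)) (hskew : ∀ i j, i < j → ¬ Disjoint (U i) (V j)) :
    m ≤ 2 ^ finrank K E := by
  have h : LinearIndependent K fun i => (U i).blade :=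
    linearIndependent_of_mul_triangular (y := fun i => (V i).blade)
      (fun i => Submodule.blade_mul_blade_ne_zero_iff.2 (hdiag i))
      fun i j hij => not_not.1 fun h => hskew i j hij (Submodule.blade_mul_blade_ne_zero_iff.1 h)
  simpa [ExteriorAlgebra.finrank_eq] using h.fintype_card_le_finrank

theorem Submodule.finrank_comap_subtype_eq_finrank_inf {K E : Type*} [Field K] [AddCommGroup E]
    [Module K E] (H S : Submodule K E) :
    finrank K (S.comap H.subtype) = finrank K ↥(H ⊓ S) := by
  rw [← finrank_map_subtype_eq, map_comap_subtype]

theorem threshold_skew_bollobas_subspaces_of_infinite {K : Type*} [Field K] [Infinite K]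
    {m : ℕ} (t : ℕ) {E : Type*} [AddCommGroup E] [Module K E] [FiniteDimensional K E]
    (ht : t ≤ finrank K E) {U V : Fin m → Submodule K E}
    (hdiag : ∀ i, finrank K ↥(U i ⊓ V i) ≤ t)
    (hskew : ∀ i j, i < j → t < finrank K ↥(U i ⊓ V j)) :
    m ≤ 2 ^ (finrank K E - t) := by
  induction t generalizing E with
  | zero =>
    refine skew_bollobas_subspaces (U := U) (V := V) (fun i => ?_) fun i j hij h => ?_
    · rw [disjoint_iff, ← Submodule.finrank_eq_zero (R := K)]
      exact Nat.le_zero.1 (hdiag i)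
    · have := hskew i j hij
      rw [disjoint_iff.1 h, finrank_bot] at this
      exact this.false
  | succ t ih =>
    rcases m.eq_zero_or_pos with rfl | hm
    · exact Nat.zero_le _
    have : Nontrivial E := nontrivial_of_finrank_pos (R := K) (by omega)
    have hv (i : Fin m) : ∃ v : E, v ≠ 0 ∧ (U i ⊓ V i ≠ ⊥ → v ∈ U i ⊓ V i) := by
      by_cases h : U i ⊓ V i = ⊥
      · obtain ⟨v, hv⟩ := exists_ne (0 : E)
        exact ⟨v, hv, fun h' => (h' h).elim⟩
      · obtain ⟨v, hv, hv0⟩ := Submodule.exists_mem_ne_zero_of_ne_bot h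
        exact ⟨v, hv0, fun _ => hv⟩
    choose v hv0 hv using hv
    obtain ⟨f, hf⟩ := exists_dual_forall_apply_ne_zero (K := K) v hv0
    have hf0 : f ≠ 0 := by
      rintro rfl
      exact hf ⟨0, hm⟩ rfl
    have hker := Dual.finrank_ker_add_one_of_ne_zero hf0
    set H := LinearMap.ker f
    have key := ih (E := H) (by omega) (U := fun i => (U i).comap H.subtype)
      (V := fun i => (V i).comap H.subtype) ?_ ?_
    · rwa [show finrank K E - (t + 1) = finrank K H - t by omega]
    · intro i
      rw [← Submodule.comap_inf, Submodule.finrank_comap_subtype_eq_finrank_inf]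
      by_cases h : U i ⊓ V i = ⊥
      · rw [h, inf_bot_eq, finrank_bot]
        exact Nat.zero_le t
      · have hlt : H ⊓ (U i ⊓ V i) < U i ⊓ V i :=
          inf_lt_right.2 fun hle => hf i (LinearMap.mem_ker.1 (hle (hv i h)))
        exact Nat.le_of_lt_succ ((Submodule.finrank_lt_finrank_of_lt hlt).trans_le (hdiag i))
    · intro i j hij
      rw [← Submodule.comap_inf, Submodule.finrank_comap_subtype_eq_finrank_inf]
      have h₁ := Submodule.finrank_sup_add_finrank_inf_eq H (U i ⊓ V j)
      have h₂ := Submodule.finrank_le (H ⊔ (U i ⊓ V j))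
      have h₃ := hskew i j hij
      omega

theorem Submodule.finrank_baseChange_eq {F E : Type*} (K : Type*) [Field F] [Field K] [Algebra F K]
    [AddCommGroup E] [Module F E] (S : Submodule F E) :
    finrank K (S.baseChange K) = finrank F S := by
  rw [← (toBaseChange.toLinearEquiv K S).finrank_eq, finrank_baseChange]

theorem Submodule.baseChange_sup_le {R M : Type*} (A : Type*) [CommRing R] [CommRing A]
    [Algebra R A] [AddCommGroup M] [Module R M] (S T : Submodule R M) :
    (S ⊔ T).baseChange A ≤ S.baseChange A ⊔ T.baseChange A := by
  rw [baseChange_eq_span, span_le]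
  rintro _ ⟨x, hx, rfl⟩
  obtain ⟨s, hs, t, ht, rfl⟩ := mem_sup.1 hx
  rw [map_add]
  exact add_mem_sup (tmul_mem_baseChange_of_mem 1 hs) (tmul_mem_baseChange_of_mem 1 ht)

theorem Submodule.finrank_baseChange_inf {F E : Type*} (K : Type*) [Field F] [Field K]
    [Algebra F K] [AddCommGroup E] [Module F E] [FiniteDimensional F E] (S T : Submodule F E) :
    finrank K ↥(S.baseChange K ⊓ T.baseChange K) = finrank F ↥(S ⊓ T) := by
  have h₁ := finrank_mono (le_inf (baseChange_mono K (inf_le_left : S ⊓ T ≤ S))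
    (baseChange_mono K (inf_le_right : S ⊓ T ≤ T)))
  have h₂ := finrank_mono (baseChange_sup_le K S T)
  have h₃ := finrank_sup_add_finrank_inf_eq S T
  have h₄ := finrank_sup_add_finrank_inf_eq (S.baseChange K) (T.baseChange K)
  simp only [finrank_baseChange_eq] at h₁ h₂ h₄
  omega

/-- Non-uniform threshold skew subspace version of Bollobás' Theorem. -/
theorem threshold_skew_bollobas_subspaces_nonuniform (F : Type*) [Field F] (W : Type*)
    [AddCommGroup W] [Module F W] [FiniteDimensional F W] (n m t : ℕ)
    (hn : Module.finrank F W = n) (ht : t ≤ n)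
    (U V : Fin m → Submodule F W)
    (hdiag : ∀ i, Module.finrank F ↥(U i ⊓ V i) ≤ t)
    (hskew : ∀ i j, i < j → t < Module.finrank F ↥(U i ⊓ V j)) :
    m ≤ 2 ^ (n - t) := by
  subst hn
  let K := AlgebraicClosure F
  have hrank : finrank K (TensorProduct F K W) = finrank F W := finrank_baseChange
  rw [← hrank] at ht ⊢
  refine threshold_skew_bollobas_subspaces_of_infinite t ht (U := fun i => (U i).baseChange K)
    (V := fun i => (V i).baseChange K) ?_ ?_
  · simpa only [Submodule.finrank_baseChange_inf] using hdiag
  · simpa only [Submodule.finrank_baseChange_inf] using hskew
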